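/- If G is a graph on n vertices such that P_ℓ(G, k) = P(G, k) for all k ≥ χ(G) (i.e., G is enumeratively chromatic-choosable), then P(G, k+1)/(k+1)^n ≥ P(G, k)/k^n for all k ∈ ℕ with k ≥ 1. -/

import Mathlib

open scoped Classical

/-- Number of proper `k`-colorings of `G` (the chromatic polynomial evaluated at `k`). -/
noncomputable def properCount {V : Type*} (G : SimpleGraph V) (k : ℕ) : ℕ :=
  Nat.card {f : V → Fin k // ∀ u v, G.Adj u v → f u ≠ f v}

/-- Number of proper `L`-colorings of `G` for a list assignment `L`. -/
noncomputable def listCount {V : Type*} (G : SimpleGraph V) (L : V → Finset ℕ) : ℕ :=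
  Nat.card {f : V → ℕ // (∀ v, f v ∈ L v) ∧ ∀ u v, G.Adj u v → f u ≠ f v}

/-- The list color function `P_ℓ(G, k)`. -/
noncomputable def listColorFn {V : Type*} (G : SimpleGraph V) (k : ℕ) : ℕ :=
  sInf {m | ∃ L : V → Finset ℕ, (∀ v, (L v).card = k) ∧ m = listCount G L}

/-- `H` (on vertex set `V × Fin k`, with `L v = {v} × Fin k`) is a `k`-fold DP-cover of `G`:
each part is a clique, cross-edges only between parts of adjacent vertices, and the
cross-edges between parts of adjacent vertices form a matching. -/
def IsDPCover {V : Type*} (G : SimpleGraph V) (k : ℕ) (H : SimpleGraph (V × Fin k)) : Prop :=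
  (∀ v : V, ∀ i j : Fin k, i ≠ j → H.Adj (v, i) (v, j)) ∧
  (∀ u v : V, ∀ i j : Fin k, H.Adj (u, i) (v, j) → u = v ∨ G.Adj u v) ∧
  (∀ u v : V, G.Adj u v →
    (∀ i j j' : Fin k, H.Adj (u, i) (v, j) → H.Adj (u, i) (v, j') → j = j') ∧
    (∀ i i' j : Fin k, H.Adj (u, i) (v, j) → H.Adj (u, i') (v, j) → i = i'))

/-- A full `k`-fold DP-cover: the matching between the parts of adjacent vertices is perfect. -/
def IsFullDPCover {V : Type*} (G : SimpleGraph V) (k : ℕ) (H : SimpleGraph (V × Fin k)) : Prop :=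
  IsDPCover G k H ∧ ∀ u v : V, G.Adj u v → ∀ i : Fin k, ∃! j : Fin k, H.Adj (u, i) (v, j)

/-- The number of `H`-colorings of `G` (independent sets of `H` with one vertex in each part,
encoded as functions `V → Fin k`). -/
noncomputable def dpCount {V : Type*} (k : ℕ) (H : SimpleGraph (V × Fin k)) : ℕ :=
  Nat.card {f : V → Fin k // ∀ u v : V, u ≠ v → ¬ H.Adj (u, f u) (v, f v)}

/-- The DP color function `P_DP(G, k)`. -/
noncomputable def dpColorFn {V : Type*} (G : SimpleGraph V) (k : ℕ) : ℕ :=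
  sInf {m | ∃ H : SimpleGraph (V × Fin k), IsDPCover G k H ∧ m = dpCount k H}

/-- The dual DP color function `P*_DP(G, k)`. -/
noncomputable def dualDPColorFn {V : Type*} (G : SimpleGraph V) (k : ℕ) : ℕ :=
  sSup {m | ∃ H : SimpleGraph (V × Fin k), IsFullDPCover G k H ∧ m = dpCount k H}

/-- A list assignment has at least as many proper colorings as the list color function counts. -/
theorem listColorFn_le_listCount {V : Type*} (G : SimpleGraph V) {k : ℕ} (L : V → Finset ℕ)
    (hL : ∀ v, (L v).card = k) : listColorFn G k ≤ listCount G L :=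
  Nat.sInf_le ⟨L, hL, rfl⟩

/-- A graph that is not `k`-colorable has no proper `k`-colorings. -/
theorem properCount_eq_zero {V : Type*} (G : SimpleGraph V) {k : ℕ} (h : ¬ G.Colorable k) :
    properCount G k = 0 := by
  have : IsEmpty {f : V → Fin k // ∀ u v, G.Adj u v → f u ≠ f v} :=
    ⟨fun f => h ⟨SimpleGraph.Coloring.mk f.1 fun {u v} huv => f.2 u v huv⟩⟩
  exact Nat.card_of_isEmpty

/-- Forbidding the color `a v` at each vertex `v` and then coloring properly from the remaining
colors amounts to choosing a proper coloring and then a forbidden color at each vertex that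
differs from the color used there. -/
def forbiddenColorEquiv {V : Type*} (G : SimpleGraph V) (n : ℕ) :
    (Σ a : V → Fin n, {f : V → ℕ //
      (∀ v, f v ∈ (Finset.range n).erase (a v)) ∧ ∀ u v, G.Adj u v → f u ≠ f v}) ≃
    (Σ f : {f : V → Fin n // ∀ u v, G.Adj u v → f u ≠ f v}, ∀ v, {i : Fin n // i ≠ f.1 v}) where
  toFun x :=
    ⟨⟨fun v => ⟨x.2.1 v, Finset.mem_range.1 (Finset.mem_of_mem_erase (x.2.2.1 v))⟩,
      fun u v huv he => x.2.2.2 u v huv (congrArg Fin.val he)⟩,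
      fun v => ⟨x.1 v, fun he => Finset.ne_of_mem_erase (x.2.2.1 v) (congrArg Fin.val he).symm⟩⟩
  invFun y :=
    ⟨fun v => (y.2 v).1, fun v => (y.1.1 v : ℕ),
      fun v => Finset.mem_erase.2
        ⟨fun he => (y.2 v).2 (Fin.ext he.symm), Finset.mem_range.2 (y.1.1 v).2⟩,
      fun u v huv he => y.1.2 u v huv (Fin.ext he)⟩
  left_inv _ := rfl
  right_inv _ := rfl

/-- Averaging over all ways to delete one of `k + 1` colors at each vertex. -/
theorem sum_listCount_erase {V : Type*} [Fintype V] (G : SimpleGraph V) (k : ℕ) :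
    ∑ a : V → Fin (k + 1), listCount G (fun v => (Finset.range (k + 1)).erase (a v)) =
      properCount G (k + 1) * k ^ Fintype.card V := by
  have hfin (a : V → Fin (k + 1)) : Finite {f : V → ℕ //
      (∀ v, f v ∈ (Finset.range (k + 1)).erase (a v)) ∧ ∀ u v, G.Adj u v → f u ≠ f v} :=
    Finite.of_injective
      (fun x v => (⟨x.1 v, Finset.mem_range.1 (Finset.mem_of_mem_erase (x.2.1 v))⟩ : Fin (k + 1)))
      fun x y h => Subtype.ext (funext fun v => congrArg Fin.val (congrFun h v))
  unfold listCount properCount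
  rw [← Nat.card_sigma, Nat.card_congr (forbiddenColorEquiv G (k + 1)), Nat.card_sigma]
  simp

/-- Cross-multiplied comparison when `P_ℓ(G, k) = P(G, k)`. -/
theorem pow_mul_properCount_le {V : Type*} [Fintype V] (G : SimpleGraph V) {k : ℕ}
    (h : listColorFn G k = properCount G k) :
    (k + 1) ^ Fintype.card V * properCount G k ≤
      properCount G (k + 1) * k ^ Fintype.card V := by
  rw [← sum_listCount_erase, ← h]
  calc (k + 1) ^ Fintype.card V * listColorFn G k
      = ∑ _a : V → Fin (k + 1), listColorFn G k := by simp
    _ ≤ _ := Finset.sum_le_sum fun a _ => listColorFn_le_listCount G _ fun v => by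
        rw [Finset.card_erase_of_mem (Finset.mem_range.2 (a v).2), Finset.card_range,
          Nat.add_sub_cancel]

theorem stmt2 {V : Type*} [Fintype V] (G : SimpleGraph V)
    (hG : ∀ k : ℕ, G.chromaticNumber ≤ k → listColorFn G k = properCount G k)
    (k : ℕ) (hk : 1 ≤ k) :
    (properCount G (k + 1) : ℝ) / ((k : ℝ) + 1) ^ (Fintype.card V) ≥
      (properCount G k : ℝ) / (k : ℝ) ^ (Fintype.card V) := by
  by_cases hc : G.Colorable k
  · have hle := pow_mul_properCount_le G (hG k hc.chromaticNumber_le)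
    rw [ge_iff_le, div_le_div_iff₀ (by positivity) (by positivity), mul_comm]
    exact_mod_cast hle
  · rw [properCount_eq_zero G hc, Nat.cast_zero, zero_div]
    positivity
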